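/- arXiv:2102.12468 — 8 statements merged into one kernel-verified Lean document; each statement's English description precedes it below -/
import Mathlib

section
/- Let λ : T∘P ⟶ P∘T be a natural transformation satisfying, for every object X, the two unit triangles λ_X ∘ u_{P X} = P(u_X) and λ_X ∘ T(η_X) = η_{T X}, together with the decagon condition. Then λ satisfies the two Beck pentagons: λ_X ∘ m_{P X} = P(m_X) ∘ λ_{T X} ∘ T(λ_X) and λ_X ∘ T(μ_X) = μ_{T X} ∘ P(λ_X) ∘ λ_{P X} for every X; consequently λ is a Beck distributive law of T over P. -/
open CategoryTheory

universe v u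

variable {C : Type u} [Category.{v} C]

/-- The monad laws for `(T, u, m)`: left unit, right unit and associativity. -/
def IsMonad (T : C ⥤ C) (u : 𝟭 C ⟶ T) (m : T ⋙ T ⟶ T) : Prop :=
  (∀ X : C, u.app (T.obj X) ≫ m.app X = 𝟙 (T.obj X)) ∧
  (∀ X : C, T.map (u.app X) ≫ m.app X = 𝟙 (T.obj X)) ∧
  (∀ X : C, m.app (T.obj X) ≫ m.app X = T.map (m.app X) ≫ m.app X)

/-- A Beck distributive law of `(T, u, m)` over `(P, η, μ)`: the two unit triangles
and the two pentagons.  (Here `P ⋙ T` is the functor `X ↦ T (P X)`, i.e. `T∘P`.) -/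
def IsBeckDistLaw (T P : C ⥤ C) (u : 𝟭 C ⟶ T) (η : 𝟭 C ⟶ P)
    (m : T ⋙ T ⟶ T) (μ : P ⋙ P ⟶ P) (lam : P ⋙ T ⟶ T ⋙ P) : Prop :=
  (∀ X : C, u.app (P.obj X) ≫ lam.app X = P.map (u.app X)) ∧
  (∀ X : C, T.map (η.app X) ≫ lam.app X = η.app (T.obj X)) ∧
  (∀ X : C, m.app (P.obj X) ≫ lam.app X =
      T.map (lam.app X) ≫ lam.app (T.obj X) ≫ P.map (m.app X)) ∧
  (∀ X : C, T.map (μ.app X) ≫ lam.app X =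
      lam.app (P.obj X) ≫ P.map (lam.app X) ≫ μ.app (T.obj X))

/-- The decagon condition for `λ : T∘P ⟶ P∘T`. -/
def Decagon (T P : C ⥤ C) (m : T ⋙ T ⟶ T) (μ : P ⋙ P ⟶ P)
    (lam : P ⋙ T ⟶ T ⋙ P) : Prop :=
  ∀ X : C,
    T.map (P.map (lam.app (T.obj X))) ≫ T.map (P.map (P.map (m.app X))) ≫
        T.map (μ.app (T.obj X)) ≫ lam.app (T.obj X) ≫ P.map (m.app X) =
    lam.app (T.obj (P.obj (T.obj X))) ≫ P.map (m.app (P.obj (T.obj X))) ≫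
        P.map (lam.app (T.obj X)) ≫ P.map (P.map (m.app X)) ≫ μ.app (T.obj X)

/-- The unit triangles and the decagon imply the pentagons, phrased for families of morphisms so
that no composite functor occurs in the types. -/
theorem pentagons_of_decagon (T P : C ⥤ C) (u : ∀ X : C, X ⟶ T.obj X) (η : ∀ X : C, X ⟶ P.obj X)
    (m : ∀ X : C, T.obj (T.obj X) ⟶ T.obj X) (μ : ∀ X : C, P.obj (P.obj X) ⟶ P.obj X)
    (lam : ∀ X : C, T.obj (P.obj X) ⟶ P.obj (T.obj X))
    (η_nat : ∀ {X Y : C} (f : X ⟶ Y), f ≫ η Y = η X ≫ P.map f)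
    (m_nat : ∀ {X Y : C} (f : X ⟶ Y), T.map (T.map f) ≫ m Y = m X ≫ T.map f)
    (μ_nat : ∀ {X Y : C} (f : X ⟶ Y), P.map (P.map f) ≫ μ Y = μ X ≫ P.map f)
    (lam_nat : ∀ {X Y : C} (f : X ⟶ Y), T.map (P.map f) ≫ lam Y = lam X ≫ P.map (T.map f))
    (hTl : ∀ X : C, u (T.obj X) ≫ m X = 𝟙 (T.obj X))
    (hTr : ∀ X : C, T.map (u X) ≫ m X = 𝟙 (T.obj X))
    (hPl : ∀ X : C, η (P.obj X) ≫ μ X = 𝟙 (P.obj X))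
    (htri1 : ∀ X : C, u (P.obj X) ≫ lam X = P.map (u X))
    (htri2 : ∀ X : C, T.map (η X) ≫ lam X = η (T.obj X))
    (hdec : ∀ X : C,
      T.map (P.map (lam (T.obj X))) ≫ T.map (P.map (P.map (m X))) ≫
          T.map (μ (T.obj X)) ≫ lam (T.obj X) ≫ P.map (m X) =
      lam (T.obj (P.obj (T.obj X))) ≫ P.map (m (P.obj (T.obj X))) ≫
          P.map (lam (T.obj X)) ≫ P.map (P.map (m X)) ≫ μ (T.obj X)) :
    (∀ X : C, m (P.obj X) ≫ lam X = T.map (lam X) ≫ lam (T.obj X) ≫ P.map (m X)) ∧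
    (∀ X : C, T.map (μ X) ≫ lam X = lam (P.obj X) ≫ P.map (lam X) ≫ μ (T.obj X)) := by
  obtain ⟨a, ha⟩ : ∃ a : ∀ X : C, T.obj (P.obj (T.obj X)) ⟶ P.obj (T.obj X),
      ∀ X, a X = lam (T.obj X) ≫ P.map (m X) := ⟨_, fun _ => rfl⟩
  have a_lam (X : C) : T.map (P.map (u X)) ≫ a X = lam X := by
    rw [ha, ← Category.assoc, lam_nat, Category.assoc, ← P.map_comp, hTr, P.map_id,
      Category.comp_id]
  have u_a (X : C) : u (P.obj (T.obj X)) ≫ a X = 𝟙 _ := by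
    rw [ha, ← Category.assoc, htri1, ← P.map_comp, hTl, P.map_id]
  have η_a (X : C) : T.map (η (T.obj X)) ≫ a X = m X ≫ η (T.obj X) := by
    rw [ha, ← Category.assoc, htri2, η_nat]
  have dec (X : C) : T.map (P.map (a X)) ≫ T.map (μ (T.obj X)) ≫ a X =
      a (P.obj (T.obj X)) ≫ P.map (a X) ≫ μ (T.obj X) := by
    simpa only [ha, Functor.map_comp, Category.assoc] using hdec X
  have a_mul (X : C) : m (P.obj (T.obj X)) ≫ a X = T.map (a X) ≫ a X := by
    have h := congrArg (T.map (η (T.obj (P.obj (T.obj X)))) ≫ ·) (dec X)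
    simp only [← Category.assoc, η_a, ← T.map_comp] at h
    rw [← η_nat, Category.assoc (a X), hPl, Category.comp_id,
      Category.assoc (m _), ← η_nat] at h
    simpa only [Category.assoc, hPl, Category.comp_id] using h.symm
  have μ_a (X : C) : T.map (μ (T.obj X)) ≫ a X =
      lam (P.obj (T.obj X)) ≫ P.map (a X) ≫ μ (T.obj X) := by
    have h := congrArg (T.map (P.map (u (P.obj (T.obj X)))) ≫ ·) (dec X)
    simp only [← Category.assoc, a_lam, ← T.map_comp, ← P.map_comp, u_a] at h
    simpa only [P.map_id, Category.id_comp, Category.assoc] using h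
  have pentagon_m (X : C) : m (P.obj X) ≫ lam X =
      T.map (lam X) ≫ lam (T.obj X) ≫ P.map (m X) := by
    rw [← ha, ← a_lam X, ← Category.assoc, ← m_nat, Category.assoc, a_mul, T.map_comp,
      Category.assoc]
  have pentagon_μ (X : C) : T.map (μ X) ≫ lam X =
      lam (P.obj X) ≫ P.map (lam X) ≫ μ (T.obj X) := by
    rw [← a_lam X, ← Category.assoc, ← T.map_comp, ← μ_nat, T.map_comp, Category.assoc, μ_a,
      ← Category.assoc, lam_nat, P.map_comp]
    simp only [Category.assoc]
  exact ⟨pentagon_m, pentagon_μ⟩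

/-- If `λ` satisfies the two unit triangles and the decagon condition, then it satisfies
the two Beck pentagons, and consequently is a Beck distributive law of `T` over `P`. -/
theorem beckDistLaw_of_decagon (T P : C ⥤ C) (u : 𝟭 C ⟶ T) (η : 𝟭 C ⟶ P)
    (m : T ⋙ T ⟶ T) (μ : P ⋙ P ⟶ P)
    (hT : IsMonad T u m) (hP : IsMonad P η μ)
    (lam : P ⋙ T ⟶ T ⋙ P)
    (htri1 : ∀ X : C, u.app (P.obj X) ≫ lam.app X = P.map (u.app X))
    (htri2 : ∀ X : C, T.map (η.app X) ≫ lam.app X = η.app (T.obj X))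
    (hdec : Decagon T P m μ lam) :
    (∀ X : C, m.app (P.obj X) ≫ lam.app X =
        T.map (lam.app X) ≫ lam.app (T.obj X) ≫ P.map (m.app X)) ∧
    (∀ X : C, T.map (μ.app X) ≫ lam.app X =
        lam.app (P.obj X) ≫ P.map (lam.app X) ≫ μ.app (T.obj X)) ∧
    IsBeckDistLaw T P u η m μ lam := by
  obtain ⟨pentagon_m, pentagon_μ⟩ := pentagons_of_decagon T P u.app η.app m.app μ.app lam.app
    (fun f => η.naturality f) (fun f => m.naturality f) (fun f => μ.naturality f)
    (fun f => lam.naturality f) hT.1 hT.2.1 hP.1 htri1 htri2 hdec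
  exact ⟨pentagon_m, pentagon_μ, htri1, htri2, pentagon_m, pentagon_μ⟩
end

section
/- The assignment sending a natural transformation λ : T∘P ⟶ P∘T to the natural transformation α : T∘P∘T ⟶ P∘T with components α_X = P(m_X) ∘ λ_{T X} is a bijection from the set of Beck distributive laws of T over P onto the set of natural transformations T∘P∘T ⟶ P∘T in algebra form, with inverse sending α to the natural transformation λ with components λ_X = α_X ∘ T(P(u_X)). -/
open CategoryTheory

universe v u

variable {C : Type u} [Category.{v} C]

def AlgebraForm (T P : C ⥤ C) (u : 𝟭 C ⟶ T) (η : 𝟭 C ⟶ P)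
    (m : T ⋙ T ⟶ T) (μ : P ⋙ P ⟶ P) (α : T ⋙ P ⋙ T ⟶ T ⋙ P) : Prop :=
  (∀ X : C, u.app (P.obj (T.obj X)) ≫ α.app X = 𝟙 (P.obj (T.obj X))) ∧
  (∀ X : C, T.map (η.app (T.obj X)) ≫ α.app X = m.app X ≫ η.app (T.obj X)) ∧
  (∀ X : C, T.map (P.map (α.app X)) ≫ T.map (μ.app (T.obj X)) ≫ α.app X =
      α.app (P.obj (T.obj X)) ≫ P.map (α.app X) ≫ μ.app (T.obj X))


section

variable {T P : C ⥤ C} {u : 𝟭 C ⟶ T} {η : 𝟭 C ⟶ P} {m : T ⋙ T ⟶ T} {μ : P ⋙ P ⟶ P}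

/-- The transformation `P(m) ∘ λ_T` attached to `λ : T∘P ⟶ P∘T`. -/
def algebraOfLaw (m : T ⋙ T ⟶ T) (lam : P ⋙ T ⟶ T ⋙ P) : T ⋙ P ⋙ T ⟶ T ⋙ P where
  app X := lam.app (T.obj X) ≫ P.map (m.app X)
  naturality X Y f := by
    have h₁ := lam.naturality (T.map f)
    have h₂ := m.naturality f
    simp only [Functor.comp_obj, Functor.comp_map] at h₁ h₂ ⊢
    rw [reassoc_of% h₁, Category.assoc, ← P.map_comp, ← P.map_comp, h₂]

/-- The transformation `α ∘ T(P(u))` attached to `α : T∘P∘T ⟶ P∘T`. -/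
def lawOfAlgebra (u : 𝟭 C ⟶ T) (α : T ⋙ P ⋙ T ⟶ T ⋙ P) : P ⋙ T ⟶ T ⋙ P where
  app X := T.map (P.map (u.app X)) ≫ α.app X
  naturality X Y f := by
    have h₁ := α.naturality f
    have h₂ := u.naturality f
    simp only [Functor.comp_obj, Functor.comp_map, Functor.id_obj, Functor.id_map] at h₁ h₂ ⊢
    rw [Category.assoc, ← h₁, ← T.map_comp_assoc, ← T.map_comp_assoc, ← P.map_comp,
      ← P.map_comp, h₂]

theorem AlgebraForm.mul_app_comp (hP : IsMonad P η μ) {α : T ⋙ P ⋙ T ⟶ T ⋙ P}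
    (h : AlgebraForm T P u η m μ α) (X : C) :
    m.app (P.obj (T.obj X)) ≫ α.app X = T.map (α.app X) ≫ α.app X := by
  obtain ⟨-, h₂, h₃⟩ := h
  have e₁ := η.naturality (α.app X)
  simp only [Functor.comp_obj, Functor.id_obj, Functor.id_map] at e₁
  have e := congrArg (T.map (η.app (T.obj (P.obj (T.obj X)))) ≫ ·) (h₃ X)
  rw [reassoc_of% (h₂ (P.obj (T.obj X))), ← reassoc_of% e₁, hP.1, Category.comp_id,
    ← T.map_comp_assoc, ← e₁, ← T.map_comp_assoc, Category.assoc, hP.1, Category.comp_id] at e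
  exact e.symm

theorem AlgebraForm.comp_map_mul (hP : IsMonad P η μ) {α : T ⋙ P ⋙ T ⟶ T ⋙ P}
    (h : AlgebraForm T P u η m μ α) (X : C) :
    α.app (T.obj X) ≫ P.map (m.app X) = T.map (P.map (m.app X)) ≫ α.app X := by
  obtain ⟨-, h₂, h₃⟩ := h
  have e₁ := α.naturality (η.app (T.obj X))
  simp only [Functor.comp_obj, Functor.comp_map, Functor.id_obj] at e₁
  have e := congrArg (T.map (P.map (T.map (η.app (T.obj X)))) ≫ ·) (h₃ X)
  rw [reassoc_of% e₁, ← P.map_comp_assoc, h₂, P.map_comp, Category.assoc, hP.2.1,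
    Category.comp_id, ← T.map_comp_assoc, ← P.map_comp, h₂, P.map_comp, ← T.map_comp_assoc,
    Category.assoc, hP.2.1, Category.comp_id] at e
  exact e.symm

theorem IsBeckDistLaw.algebraForm (hT : IsMonad T u m) {lam : P ⋙ T ⟶ T ⋙ P}
    (h : IsBeckDistLaw T P u η m μ lam) :
    AlgebraForm T P u η m μ (algebraOfLaw m lam) := by
  obtain ⟨h₁, h₂, h₃, h₄⟩ := h
  refine ⟨fun X => ?_, fun X => ?_, fun X => ?_⟩
  · dsimp only [algebraOfLaw, Functor.comp_obj]
    rw [reassoc_of% (h₁ (T.obj X)), ← P.map_comp, hT.1, P.map_id]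
  · have e := η.naturality (m.app X)
    dsimp only [algebraOfLaw, Functor.comp_obj, Functor.id_obj, Functor.id_map] at e ⊢
    rw [reassoc_of% (h₂ (T.obj X)), e]
  · have e₁ := μ.naturality (m.app X)
    have e₂ := lam.naturality (P.map (m.app X))
    have e₃ := lam.naturality (m.app X)
    have e₄ := lam.naturality (lam.app (T.obj X))
    dsimp only [algebraOfLaw, Functor.comp_obj, Functor.comp_map] at e₁ e₂ e₃ e₄ ⊢
    calc
      _ = T.map (P.map (lam.app (T.obj X))) ≫ T.map (P.map (P.map (m.app X))) ≫
            lam.app (P.obj (T.obj X)) ≫ P.map (lam.app (T.obj X)) ≫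
            μ.app (T.obj (T.obj X)) ≫ P.map (m.app X) := by
        rw [reassoc_of% (h₄ (T.obj X))]
        simp only [Functor.map_comp, Category.assoc]
      _ = lam.app (T.obj (P.obj (T.obj X))) ≫ P.map (T.map (lam.app (T.obj X))) ≫
            P.map (lam.app (T.obj (T.obj X))) ≫ P.map (P.map (T.map (m.app X))) ≫
            P.map (P.map (m.app X)) ≫ μ.app (T.obj X) := by
        rw [← e₁, reassoc_of% e₂, ← P.map_comp_assoc (T.map _), e₃, P.map_comp_assoc,
          reassoc_of% e₄]
      _ = _ := by
        rw [← P.map_comp_assoc (P.map (T.map (m.app X))), ← P.map_comp (T.map (m.app X)),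
          ← hT.2.2]
        simp only [Category.assoc, ← P.map_comp_assoc]
        rw [reassoc_of% (h₃ (T.obj X))]
        simp only [Functor.map_comp, Category.assoc]

theorem AlgebraForm.isBeckDistLaw (hT : IsMonad T u m) (hP : IsMonad P η μ)
    {α : T ⋙ P ⋙ T ⟶ T ⋙ P} (h : AlgebraForm T P u η m μ α) :
    IsBeckDistLaw T P u η m μ (lawOfAlgebra u α) := by
  have hm := h.mul_app_comp hP
  have hc := h.comp_map_mul hP
  obtain ⟨h₁, h₂, h₃⟩ := h
  refine ⟨fun X => ?_, fun X => ?_, fun X => ?_, fun X => ?_⟩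
  · have e := u.naturality (P.map (u.app X))
    dsimp only [lawOfAlgebra, Functor.comp_obj, Functor.id_obj, Functor.id_map] at e ⊢
    rw [← reassoc_of% e, h₁, Category.comp_id]
  · have e := η.naturality (u.app X)
    dsimp only [lawOfAlgebra, Functor.comp_obj, Functor.id_obj, Functor.id_map] at e ⊢
    rw [← T.map_comp_assoc, ← e, T.map_comp_assoc, h₂, reassoc_of% (hT.2.1 X)]
  · have e := m.naturality (P.map (u.app X))
    dsimp only [lawOfAlgebra, Functor.comp_obj, Functor.comp_map, Functor.id_obj] at e ⊢
    rw [← reassoc_of% e, hm, Category.assoc, hc, ← T.map_comp_assoc (P.map (u.app _)),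
      ← P.map_comp, hT.1]
    dsimp only [Functor.id_obj]
    rw [P.map_id, T.map_id, Category.id_comp, T.map_comp_assoc]
  · have e₁ := μ.naturality (u.app X)
    have e₂ := α.naturality (P.map (u.app X))
    have e₃ := u.naturality (P.map (u.app X))
    dsimp only [lawOfAlgebra, Functor.comp_obj, Functor.comp_map, Functor.id_obj,
      Functor.id_map] at e₁ e₂ e₃ ⊢
    rw [P.map_comp, Category.assoc, Category.assoc, ← reassoc_of% e₂, ← h₃,
      ← T.map_comp_assoc, ← e₁]
    simp only [← T.map_comp_assoc, ← P.map_comp_assoc]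
    rw [← reassoc_of% e₃, h₁, Category.comp_id]

theorem lawOfAlgebra_algebraOfLaw (hT : IsMonad T u m) (lam : P ⋙ T ⟶ T ⋙ P) :
    lawOfAlgebra u (algebraOfLaw m lam) = lam := by
  ext X
  have e := lam.naturality (u.app X)
  dsimp only [lawOfAlgebra, algebraOfLaw, Functor.comp_obj, Functor.comp_map,
    Functor.id_obj] at e ⊢
  rw [reassoc_of% e, ← P.map_comp, hT.2.1, P.map_id, Category.comp_id]

theorem AlgebraForm.algebraOfLaw_lawOfAlgebra (hT : IsMonad T u m) (hP : IsMonad P η μ)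
    {α : T ⋙ P ⋙ T ⟶ T ⋙ P} (h : AlgebraForm T P u η m μ α) :
    algebraOfLaw m (lawOfAlgebra u α) = α := by
  ext X
  dsimp only [lawOfAlgebra, algebraOfLaw, Functor.comp_obj, Functor.id_obj]
  rw [Category.assoc, h.comp_map_mul hP, ← T.map_comp_assoc, ← P.map_comp, hT.1, P.map_id,
    T.map_id, Category.id_comp]

end

/-- The assignment `λ ↦ (α_X = P(m_X) ∘ λ_{T X})` is a bijection from Beck distributive
laws of `T` over `P` to natural transformations `T∘P∘T ⟶ P∘T` in algebra form, with
inverse `α ↦ (λ_X = α_X ∘ T(P(u_X)))`. -/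
theorem beckDistLaw_equiv_algebraForm (T P : C ⥤ C) (u : 𝟭 C ⟶ T) (η : 𝟭 C ⟶ P)
    (m : T ⋙ T ⟶ T) (μ : P ⋙ P ⟶ P)
    (hT : IsMonad T u m) (hP : IsMonad P η μ) :
    ∃ e : {lam : P ⋙ T ⟶ T ⋙ P // IsBeckDistLaw T P u η m μ lam} ≃
          {α : T ⋙ P ⋙ T ⟶ T ⋙ P // AlgebraForm T P u η m μ α},
      (∀ (lam : {lam : P ⋙ T ⟶ T ⋙ P // IsBeckDistLaw T P u η m μ lam}) (X : C),
          (e lam).1.app X = lam.1.app (T.obj X) ≫ P.map (m.app X)) ∧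
      (∀ (α : {α : T ⋙ P ⋙ T ⟶ T ⋙ P // AlgebraForm T P u η m μ α}) (X : C),
          (e.symm α).1.app X = T.map (P.map (u.app X)) ≫ α.1.app X) := by
  exact ⟨{
      toFun := fun lam => ⟨algebraOfLaw m lam.1, lam.2.algebraForm hT⟩
      invFun := fun α => ⟨lawOfAlgebra u α.1, α.2.isBeckDistLaw hT hP⟩
      left_inv := fun lam => Subtype.ext (lawOfAlgebra_algebraOfLaw hT lam.1)
      right_inv := fun α => Subtype.ext (α.2.algebraOfLaw_lawOfAlgebra hT hP) },
    fun _ _ => rfl, fun _ _ => rfl⟩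
end

section
/- If α : T∘P∘T ⟶ P∘T is a natural transformation in algebra form, then the natural transformation λ : T∘P ⟶ P∘T with components λ_X = α_X ∘ T(P(u_X)) is a Beck distributive law of T over P. -/
open CategoryTheory

universe v u

variable {C : Type u} [Category.{v} C]

section AlgebraForm

variable {T P : C ⥤ C} {u : 𝟭 C ⟶ T} {η : 𝟭 C ⟶ P} {m : T ⋙ T ⟶ T} {μ : P ⋙ P ⟶ P}
  {α : T ⋙ P ⋙ T ⟶ T ⋙ P}

/-- The components of a transformation in algebra form are compatible with the
multiplication of `T` as an action on `P T X`. -/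
theorem AlgebraForm.mul_act (hP : IsMonad P η μ) (hα : AlgebraForm T P u η m μ α) (X : C) :
    m.app (P.obj (T.obj X)) ≫ α.app X = T.map (α.app X) ≫ α.app X := by
  obtain ⟨-, hη, hex⟩ := hα
  obtain ⟨hl, -, -⟩ := hP
  have nat₁ : α.app X ≫ η.app (P.obj (T.obj X)) =
      η.app (T.obj (P.obj (T.obj X))) ≫ P.map (α.app X) := η.naturality (α.app X)
  calc m.app (P.obj (T.obj X)) ≫ α.app X
      = m.app (P.obj (T.obj X)) ≫ α.app X ≫ η.app (P.obj (T.obj X)) ≫ μ.app (T.obj X) := by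
        rw [hl]; exact congrArg _ (Category.comp_id _).symm
    _ = (m.app (P.obj (T.obj X)) ≫ η.app (T.obj (P.obj (T.obj X)))) ≫
          P.map (α.app X) ≫ μ.app (T.obj X) := by
        have h := congrArg (fun f => m.app (P.obj (T.obj X)) ≫ f ≫ μ.app (T.obj X)) nat₁
        simpa only [Category.assoc] using h
    _ = T.map (η.app (T.obj (P.obj (T.obj X)))) ≫
          α.app (P.obj (T.obj X)) ≫ P.map (α.app X) ≫ μ.app (T.obj X) := by
        rw [← hη]; exact Category.assoc _ _ _
    _ = T.map (η.app (T.obj (P.obj (T.obj X))) ≫ P.map (α.app X)) ≫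
          T.map (μ.app (T.obj X)) ≫ α.app X := by
        rw [← hex, T.map_comp]; exact (Category.assoc _ _ _).symm
    _ = T.map (α.app X ≫ η.app (P.obj (T.obj X)) ≫ μ.app (T.obj X)) ≫ α.app X := by
        rw [← nat₁]; simp only [Functor.map_comp, Category.assoc]
    _ = T.map (α.app X) ≫ α.app X := by
        rw [hl]; exact congrArg (fun f => T.map f ≫ α.app X) (Category.comp_id _)

/-- A transformation in algebra form commutes with the multiplication of `T`, although the
latter is not in general the image under `T` of a morphism. -/
theorem AlgebraForm.map_mul (hP : IsMonad P η μ) (hα : AlgebraForm T P u η m μ α) (X : C) :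
    T.map (P.map (m.app X)) ≫ α.app X = α.app (T.obj X) ≫ P.map (m.app X) := by
  obtain ⟨-, hη, hex⟩ := hα
  obtain ⟨-, hr, -⟩ := hP
  have nat₁ : T.map (P.map (T.map (η.app (T.obj X)))) ≫ α.app (P.obj (T.obj X)) =
      α.app (T.obj X) ≫ P.map (T.map (η.app (T.obj X))) := α.naturality (η.app (T.obj X))
  have key : P.map (T.map (η.app (T.obj X))) ≫ P.map (α.app X) ≫ μ.app (T.obj X) =
      P.map (m.app X) := by
    have h : P.map (T.map (η.app (T.obj X))) ≫ P.map (α.app X) =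
        P.map (m.app X) ≫ P.map (η.app (T.obj X)) := by
      rw [← P.map_comp, ← P.map_comp]; exact congrArg P.map (hη X)
    have h' := congrArg (fun f => f ≫ μ.app (T.obj X)) h
    refine (Category.assoc _ _ _).symm.trans (h'.trans ((Category.assoc _ _ _).trans ?_))
    exact (congrArg _ (hr _)).trans (Category.comp_id _)
  calc T.map (P.map (m.app X)) ≫ α.app X
      = T.map (P.map (T.map (η.app (T.obj X))) ≫ P.map (α.app X) ≫ μ.app (T.obj X)) ≫
          α.app X := by rw [key]
    _ = T.map (P.map (T.map (η.app (T.obj X)))) ≫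
          T.map (P.map (α.app X)) ≫ T.map (μ.app (T.obj X)) ≫ α.app X := by
        simp only [Functor.map_comp, Category.assoc]
    _ = (T.map (P.map (T.map (η.app (T.obj X)))) ≫ α.app (P.obj (T.obj X))) ≫
          P.map (α.app X) ≫ μ.app (T.obj X) := by
        rw [hex]; exact (Category.assoc _ _ _).symm
    _ = α.app (T.obj X) ≫ P.map (T.map (η.app (T.obj X))) ≫ P.map (α.app X) ≫
          μ.app (T.obj X) := by
        rw [nat₁]; exact Category.assoc _ _ _
    _ = α.app (T.obj X) ≫ P.map (m.app X) := congrArg _ key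

end AlgebraForm

/-- If `α` is in algebra form, then `λ` with components `λ_X = α_X ∘ T(P(u_X))`
is a Beck distributive law of `T` over `P`. -/
theorem beckDistLaw_of_algebraForm (T P : C ⥤ C) (u : 𝟭 C ⟶ T) (η : 𝟭 C ⟶ P)
    (m : T ⋙ T ⟶ T) (μ : P ⋙ P ⟶ P)
    (hT : IsMonad T u m) (hP : IsMonad P η μ)
    (α : T ⋙ P ⋙ T ⟶ T ⋙ P) (hα : AlgebraForm T P u η m μ α)
    (lam : P ⋙ T ⟶ T ⋙ P)
    (hlam : ∀ X : C, lam.app X = T.map (P.map (u.app X)) ≫ α.app X) :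
    IsBeckDistLaw T P u η m μ lam := by
  have hmul := hα.mul_act hP
  have hmap := hα.map_mul hP
  obtain ⟨hu, hη, hex⟩ := hα
  obtain ⟨hTl, hTr, -⟩ := hT
  refine ⟨fun X => ?_, fun X => ?_, fun X => ?_, fun X => ?_⟩
  · have nat₁ : u.app (P.obj X) ≫ T.map (P.map (u.app X)) =
        P.map (u.app X) ≫ u.app (P.obj (T.obj X)) := (u.naturality (P.map (u.app X))).symm
    rw [hlam]
    calc u.app (P.obj X) ≫ T.map (P.map (u.app X)) ≫ α.app X
        = (u.app (P.obj X) ≫ T.map (P.map (u.app X))) ≫ α.app X := (Category.assoc _ _ _).symm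
      _ = P.map (u.app X) ≫ u.app (P.obj (T.obj X)) ≫ α.app X := by
          rw [nat₁]; exact Category.assoc _ _ _
      _ = P.map (u.app X) := (congrArg _ (hu X)).trans (Category.comp_id _)
  · have nat₁ : η.app X ≫ P.map (u.app X) = u.app X ≫ η.app (T.obj X) :=
      (η.naturality (u.app X)).symm
    rw [hlam]
    calc T.map (η.app X) ≫ T.map (P.map (u.app X)) ≫ α.app X
        = T.map (η.app X ≫ P.map (u.app X)) ≫ α.app X := by
          rw [T.map_comp]; exact (Category.assoc _ _ _).symm
      _ = T.map (u.app X) ≫ T.map (η.app (T.obj X)) ≫ α.app X := by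
          rw [nat₁, T.map_comp]; exact Category.assoc _ _ _
      _ = (T.map (u.app X) ≫ m.app X) ≫ η.app (T.obj X) := by
          rw [hη]; exact (Category.assoc _ _ _).symm
      _ = η.app (T.obj X) := by rw [hTr]; exact Category.id_comp _
  · have hlam_mul : lam.app (T.obj X) ≫ P.map (m.app X) = α.app X := by
      rw [hlam]
      calc (T.map (P.map (u.app (T.obj X))) ≫ α.app (T.obj X)) ≫ P.map (m.app X)
          = T.map (P.map (u.app (T.obj X))) ≫ T.map (P.map (m.app X)) ≫ α.app X := by
            rw [hmap]; exact Category.assoc _ _ _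
        _ = T.map (P.map (u.app (T.obj X) ≫ m.app X)) ≫ α.app X := by
            rw [P.map_comp, T.map_comp]; exact (Category.assoc _ _ _).symm
        _ = α.app X := by
            have h : T.map (P.map (u.app (T.obj X) ≫ m.app X)) = 𝟙 _ :=
              (congrArg T.map ((congrArg P.map (hTl X)).trans (P.map_id _))).trans (T.map_id _)
            exact (congrArg (· ≫ α.app X) h).trans (Category.id_comp _)
    have nat₁ : m.app (P.obj X) ≫ T.map (P.map (u.app X)) =
        T.map (T.map (P.map (u.app X))) ≫ m.app (P.obj (T.obj X)) :=
      (m.naturality (P.map (u.app X))).symm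
    calc m.app (P.obj X) ≫ lam.app X
        = (m.app (P.obj X) ≫ T.map (P.map (u.app X))) ≫ α.app X := by
          rw [hlam]; exact (Category.assoc _ _ _).symm
      _ = T.map (T.map (P.map (u.app X))) ≫ T.map (α.app X) ≫ α.app X := by
          rw [nat₁, ← hmul]; exact Category.assoc _ _ _
      _ = T.map (lam.app X) ≫ α.app X := by
          rw [hlam, T.map_comp]; exact (Category.assoc _ _ _).symm
      _ = T.map (lam.app X) ≫ lam.app (T.obj X) ≫ P.map (m.app X) := by rw [hlam_mul]
  · have hμ : T.map (μ.app (T.obj X)) ≫ α.app X =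
        lam.app (P.obj (T.obj X)) ≫ P.map (α.app X) ≫ μ.app (T.obj X) := by
      rw [hlam]
      calc T.map (μ.app (T.obj X)) ≫ α.app X
          = T.map (P.map (u.app (P.obj (T.obj X)) ≫ α.app X)) ≫
              T.map (μ.app (T.obj X)) ≫ α.app X := by
            have h : T.map (P.map (u.app (P.obj (T.obj X)) ≫ α.app X)) = 𝟙 _ :=
              (congrArg T.map ((congrArg P.map (hu X)).trans (P.map_id _))).trans (T.map_id _)
            rw [h]; exact (Category.id_comp _).symm
        _ = T.map (P.map (u.app (P.obj (T.obj X)))) ≫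
              T.map (P.map (α.app X)) ≫ T.map (μ.app (T.obj X)) ≫ α.app X := by
            rw [P.map_comp, T.map_comp]; exact Category.assoc _ _ _
        _ = (T.map (P.map (u.app (P.obj (T.obj X)))) ≫ α.app (P.obj (T.obj X))) ≫
              P.map (α.app X) ≫ μ.app (T.obj X) := by
            rw [hex]; exact (Category.assoc _ _ _).symm
    have nat₁ : μ.app X ≫ P.map (u.app X) = P.map (P.map (u.app X)) ≫ μ.app (T.obj X) :=
      (μ.naturality (u.app X)).symm
    have nat₂ : T.map (P.map (P.map (u.app X))) ≫ lam.app (P.obj (T.obj X)) =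
        lam.app (P.obj X) ≫ P.map (T.map (P.map (u.app X))) :=
      lam.naturality (P.map (u.app X))
    calc T.map (μ.app X) ≫ lam.app X
        = T.map (μ.app X ≫ P.map (u.app X)) ≫ α.app X := by
          rw [hlam, T.map_comp]; exact (Category.assoc _ _ _).symm
      _ = T.map (P.map (P.map (u.app X))) ≫ T.map (μ.app (T.obj X)) ≫ α.app X := by
          rw [nat₁, T.map_comp]; exact Category.assoc _ _ _
      _ = (T.map (P.map (P.map (u.app X))) ≫ lam.app (P.obj (T.obj X))) ≫
            P.map (α.app X) ≫ μ.app (T.obj X) := by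
          rw [hμ]; exact (Category.assoc _ _ _).symm
      _ = lam.app (P.obj X) ≫ P.map (T.map (P.map (u.app X))) ≫ P.map (α.app X) ≫
            μ.app (T.obj X) := by
          rw [nat₂]; exact Category.assoc _ _ _
      _ = lam.app (P.obj X) ≫ P.map (lam.app X) ≫ μ.app (T.obj X) := by
          rw [hlam X, P.map_comp]; exact congrArg _ (Category.assoc _ _ _).symm
end

section
/- If α : T∘P∘T ⟶ P∘T is a natural transformation in algebra form, then α satisfies the T-algebra multiplication compatibility axiom: for every object X, α_X ∘ T(P(m_X)) = P(m_X) ∘ α_{T X} as morphisms T P T T X ⟶ P T X. (Thus this axiom of Marmolejo–Rosebrugh–Wood is redundant given the three algebra-form axioms.) -/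
open CategoryTheory

universe v u

variable {C : Type u} [Category.{v} C]

/-- If `α` is in algebra form, then `α_X ∘ T(P(m_X)) = P(m_X) ∘ α_{T X}`:
the Marmolejo–Rosebrugh–Wood `T`-algebra multiplication compatibility axiom is redundant. -/
theorem algebraForm_map_mul_compat (T P : C ⥤ C) (u : 𝟭 C ⟶ T) (η : 𝟭 C ⟶ P)
    (m : T ⋙ T ⟶ T) (μ : P ⋙ P ⟶ P)
    (hT : IsMonad T u m) (hP : IsMonad P η μ)
    (α : T ⋙ P ⋙ T ⟶ T ⋙ P) (hα : AlgebraForm T P u η m μ α) :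
    ∀ X : C, T.map (P.map (m.app X)) ≫ α.app X = α.app (T.obj X) ≫ P.map (m.app X) := by
  intro X
  obtain ⟨-, hunit, hhex⟩ := hα
  have hPm : P.map (T.map (η.app (T.obj X))) ≫ P.map (α.app X) ≫ μ.app (T.obj X) =
      P.map (m.app X) := by
    have h := congrArg (fun f => P.map f ≫ μ.app (T.obj X)) (hunit X)
    simp only [Functor.map_comp, Category.assoc] at h
    exact h.trans ((congrArg (P.map (m.app X) ≫ ·) (hP.2.1 (T.obj X))).trans
      (Category.comp_id _))
  have hnat : T.map (P.map (T.map (η.app (T.obj X)))) ≫ α.app (P.obj (T.obj X)) =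
      α.app (T.obj X) ≫ P.map (T.map (η.app (T.obj X))) :=
    α.naturality (η.app (T.obj X))
  calc T.map (P.map (m.app X)) ≫ α.app X
      = T.map (P.map (T.map (η.app (T.obj X)))) ≫
          T.map (P.map (α.app X)) ≫ T.map (μ.app (T.obj X)) ≫ α.app X := by
        rw [← hPm]
        simp only [Functor.map_comp, Category.assoc]
    _ = T.map (P.map (T.map (η.app (T.obj X)))) ≫
          α.app (P.obj (T.obj X)) ≫ P.map (α.app X) ≫ μ.app (T.obj X) := by
        rw [hhex X]
    _ = (T.map (P.map (T.map (η.app (T.obj X)))) ≫ α.app (P.obj (T.obj X))) ≫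
          P.map (α.app X) ≫ μ.app (T.obj X) := (Category.assoc _ _ _).symm
    _ = (α.app (T.obj X) ≫ P.map (T.map (η.app (T.obj X)))) ≫
          P.map (α.app X) ≫ μ.app (T.obj X) :=
        congrArg (· ≫ P.map (α.app X) ≫ μ.app (T.obj X)) hnat
    _ = α.app (T.obj X) ≫ P.map (T.map (η.app (T.obj X))) ≫
          P.map (α.app X) ≫ μ.app (T.obj X) := Category.assoc _ _ _
    _ = α.app (T.obj X) ≫ P.map (m.app X) :=
        congrArg (α.app (T.obj X) ≫ ·) hPm
end

section
/- If α : T∘P∘T ⟶ P∘T is a natural transformation in algebra form, then α is a T-algebra structure map on the endofunctor P∘T: for every object X, α_X ∘ m_{P T X} = α_X ∘ T(α_X) as morphisms T T P T X ⟶ P T X (the unit law α_X ∘ u_{P T X} = id being axiom (i)). -/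
open CategoryTheory

universe v u

variable {C : Type u} [Category.{v} C]

/-- If `α` is in algebra form, then `α` is a `T`-algebra structure map on `P∘T`:
`α_X ∘ m_{P T X} = α_X ∘ T(α_X)`. -/
theorem algebraForm_is_algebra_structure (T P : C ⥤ C) (u : 𝟭 C ⟶ T) (η : 𝟭 C ⟶ P)
    (m : T ⋙ T ⟶ T) (μ : P ⋙ P ⟶ P)
    (hT : IsMonad T u m) (hP : IsMonad P η μ)
    (α : T ⋙ P ⋙ T ⟶ T ⋙ P) (hα : AlgebraForm T P u η m μ α) :
    ∀ X : C, m.app (P.obj (T.obj X)) ≫ α.app X = T.map (α.app X) ≫ α.app X := by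
  obtain ⟨-, hαη, hαμ⟩ := hα
  intro X
  have unit_left : ∀ {A : C} (f : A ⟶ P.obj (T.obj X)),
      η.app A ≫ P.map f ≫ μ.app (T.obj X) = f := fun f => by
    have nat : f ≫ η.app (P.obj (T.obj X)) = η.app _ ≫ P.map f := η.naturality f
    rw [← Category.assoc, ← nat, Category.assoc]
    exact (congrArg (f ≫ ·) (hP.1 (T.obj X))).trans (Category.comp_id f)
  calc m.app (P.obj (T.obj X)) ≫ α.app X
      = m.app (P.obj (T.obj X)) ≫ η.app (T.obj (P.obj (T.obj X))) ≫
          P.map (α.app X) ≫ μ.app (T.obj X) :=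
        congrArg (m.app (P.obj (T.obj X)) ≫ ·) (unit_left (α.app X)).symm
    _ = T.map (η.app (T.obj (P.obj (T.obj X)))) ≫ α.app (P.obj (T.obj X)) ≫
          P.map (α.app X) ≫ μ.app (T.obj X) :=
        ((reassoc_of% hαη) (P.obj (T.obj X)) (P.map (α.app X) ≫ μ.app (T.obj X))).symm
    _ = T.map (η.app (T.obj (P.obj (T.obj X)))) ≫ T.map (P.map (α.app X)) ≫
          T.map (μ.app (T.obj X)) ≫ α.app X :=
        congrArg (T.map (η.app (T.obj (P.obj (T.obj X)))) ≫ ·) (hαμ X).symm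
    _ = T.map (η.app (T.obj (P.obj (T.obj X))) ≫ P.map (α.app X) ≫ μ.app (T.obj X)) ≫
          α.app X := by
        simp only [T.map_comp, Category.assoc]
    _ = T.map (α.app X) ≫ α.app X :=
        congrArg (fun g => T.map g ≫ α.app X) (unit_left (α.app X))
end

section
/- A natural transformation α : T∘P∘T ⟶ P∘T is in algebra form if and only if it satisfies the five Marmolejo–Rosebrugh–Wood conditions: for every object X, (1) α_X ∘ u_{P T X} = id_{P T X}; (2) α_X ∘ m_{P T X} = α_X ∘ T(α_X); (3) α_X ∘ T(P(m_X)) = P(m_X) ∘ α_{T X}; (4) α_X ∘ T(η_{T X}) = η_{T X} ∘ m_X; (5) α_X ∘ T(μ_{T X}) = μ_{T X} ∘ P(α_X) ∘ α_{P T X} ∘ T(P(u_{P T X})). -/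
open CategoryTheory

universe v u

variable {C : Type u} [Category.{v} C]

/-- `α` is in algebra form iff it satisfies the five Marmolejo–Rosebrugh–Wood conditions. -/
theorem algebraForm_iff_MRW (T P : C ⥤ C) (u : 𝟭 C ⟶ T) (η : 𝟭 C ⟶ P)
    (m : T ⋙ T ⟶ T) (μ : P ⋙ P ⟶ P)
    (hT : IsMonad T u m) (hP : IsMonad P η μ)
    (α : T ⋙ P ⋙ T ⟶ T ⋙ P) :
    AlgebraForm T P u η m μ α ↔
      ((∀ X : C, u.app (P.obj (T.obj X)) ≫ α.app X = 𝟙 (P.obj (T.obj X))) ∧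
       (∀ X : C, m.app (P.obj (T.obj X)) ≫ α.app X = T.map (α.app X) ≫ α.app X) ∧
       (∀ X : C, T.map (P.map (m.app X)) ≫ α.app X = α.app (T.obj X) ≫ P.map (m.app X)) ∧
       (∀ X : C, T.map (η.app (T.obj X)) ≫ α.app X = m.app X ≫ η.app (T.obj X)) ∧
       (∀ X : C, T.map (μ.app (T.obj X)) ≫ α.app X =
          T.map (P.map (u.app (P.obj (T.obj X)))) ≫ α.app (P.obj (T.obj X)) ≫
            P.map (α.app X) ≫ μ.app (T.obj X))) := by
  obtain ⟨hTl, -, -⟩ := hT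
  obtain ⟨hPl, hPr, -⟩ := hP
  have nα : ∀ {X Y : C} (f : X ⟶ Y),
      T.map (P.map (T.map f)) ≫ α.app Y = α.app X ≫ P.map (T.map f) :=
    fun f => α.naturality f
  have nη : ∀ {X Y : C} (f : X ⟶ Y), f ≫ η.app Y = η.app X ≫ P.map f :=
    fun f => η.naturality f
  have nu : ∀ {X Y : C} (f : X ⟶ Y), f ≫ u.app Y = u.app X ≫ T.map f :=
    fun f => u.naturality f
  constructor
  · rintro ⟨h_unit, hη, hex⟩
    refine ⟨h_unit, fun X => ?_, fun X => ?_, hη, fun X => ?_⟩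
    · calc m.app (P.obj (T.obj X)) ≫ α.app X
          = m.app (P.obj (T.obj X)) ≫ α.app X ≫ η.app (P.obj (T.obj X)) ≫
              μ.app (T.obj X) := by
            rw [hPl]; exact congrArg _ (Category.comp_id _).symm
        _ = (m.app (P.obj (T.obj X)) ≫ η.app (T.obj (P.obj (T.obj X)))) ≫
              P.map (α.app X) ≫ μ.app (T.obj X) := by
            rw [← Category.assoc (α.app X)]
            erw [nη (α.app X)]
            simp only [Category.assoc]
            rfl
        _ = T.map (η.app (T.obj (P.obj (T.obj X)))) ≫ α.app (P.obj (T.obj X)) ≫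
              P.map (α.app X) ≫ μ.app (T.obj X) := by
            rw [← hη]; exact Category.assoc _ _ _
        _ = T.map (η.app (T.obj (P.obj (T.obj X))) ≫ P.map (α.app X) ≫
              μ.app (T.obj X)) ≫ α.app X := by
            rw [← hex]; simp only [Functor.map_comp, Category.assoc]
        _ = T.map (α.app X ≫ η.app (P.obj (T.obj X)) ≫ μ.app (T.obj X)) ≫ α.app X := by
            congr 2
            rw [← Category.assoc, ← Category.assoc]
            exact congrArg (· ≫ μ.app (T.obj X)) (nη (α.app X)).symm
        _ = T.map (α.app X) ≫ α.app X := by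
            rw [hPl]; exact congrArg (fun f => T.map f ≫ α.app X) (Category.comp_id _)
    · calc T.map (P.map (m.app X)) ≫ α.app X
          = T.map (P.map (m.app X ≫ η.app (T.obj X)) ≫ μ.app (T.obj X)) ≫ α.app X := by
            congr 2
            rw [P.map_comp, Category.assoc, hPr]
            exact (Category.comp_id _).symm
        _ = T.map (P.map (T.map (η.app (T.obj X)))) ≫ T.map (P.map (α.app X)) ≫
              T.map (μ.app (T.obj X)) ≫ α.app X := by
            rw [← hη]; simp only [Functor.map_comp, Category.assoc]
        _ = (T.map (P.map (T.map (η.app (T.obj X)))) ≫ α.app (P.obj (T.obj X))) ≫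
              P.map (α.app X) ≫ μ.app (T.obj X) := by
            rw [hex]; exact (Category.assoc _ _ _).symm
        _ = α.app (T.obj X) ≫ P.map (T.map (η.app (T.obj X)) ≫ α.app X) ≫
              μ.app (T.obj X) := by
            erw [nα (η.app (T.obj X))]
            simp only [Functor.map_comp, Category.assoc]; rfl
        _ = α.app (T.obj X) ≫ P.map (m.app X) := by
            rw [hη, P.map_comp, Category.assoc, hPr]
            exact congrArg _ (Category.comp_id _)
    · rw [← hex, ← Category.assoc, ← T.map_comp, ← P.map_comp]
      erw [h_unit, P.map_id, T.map_id, Category.id_comp]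
  · rintro ⟨h_unit, h_mul, h_nat, hη, hμ⟩
    refine ⟨h_unit, hη, fun X => ?_⟩
    calc T.map (P.map (α.app X)) ≫ T.map (μ.app (T.obj X)) ≫ α.app X
        = T.map (P.map (α.app X ≫ u.app (P.obj (T.obj X)))) ≫ α.app (P.obj (T.obj X)) ≫
            P.map (α.app X) ≫ μ.app (T.obj X) := by
          rw [hμ]; simp only [Functor.map_comp, Category.assoc]
      _ = T.map (P.map (u.app (T.obj (P.obj (T.obj X))))) ≫
            (T.map (P.map (T.map (α.app X))) ≫ α.app (P.obj (T.obj X))) ≫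
            P.map (α.app X) ≫ μ.app (T.obj X) := by
          erw [nu (α.app X)]
          simp only [Functor.map_comp, Category.assoc]; rfl
      _ = T.map (P.map (u.app (T.obj (P.obj (T.obj X))))) ≫
            α.app (T.obj (P.obj (T.obj X))) ≫
            P.map (T.map (α.app X) ≫ α.app X) ≫ μ.app (T.obj X) := by
          erw [nα (α.app X)]
          simp only [Functor.map_comp, Category.assoc]; rfl
      _ = T.map (P.map (u.app (T.obj (P.obj (T.obj X))))) ≫
            (α.app (T.obj (P.obj (T.obj X))) ≫ P.map (m.app (P.obj (T.obj X)))) ≫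
            P.map (α.app X) ≫ μ.app (T.obj X) := by
          rw [← h_mul]
          simp only [Functor.map_comp, Category.assoc]
      _ = T.map (P.map (u.app (T.obj (P.obj (T.obj X))) ≫ m.app (P.obj (T.obj X)))) ≫
            α.app (P.obj (T.obj X)) ≫ P.map (α.app X) ≫ μ.app (T.obj X) := by
          rw [← h_nat]
          simp only [Functor.map_comp, Category.assoc]
      _ = α.app (P.obj (T.obj X)) ≫ P.map (α.app X) ≫ μ.app (T.obj X) := by
          erw [hTl, P.map_id, T.map_id]
          exact Category.id_comp _
end

section
/- If λ : T∘P ⟶ P∘T is a Beck distributive law of T over P, then the family of functions Λ_{X,Y} : C(X, P T Y) → C(T X, P T Y) defined by Λ_{X,Y}(f) = P(m_Y) ∘ λ_{T Y} ∘ T(f) is a no-iteration distributive-law operator for T over P, i.e. it satisfies axioms (a), (b) and (c). -/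
open CategoryTheory

universe v u

variable {C : Type u} [Category.{v} C]

/-- A no-iteration distributive-law operator for `T` over `P`. -/
def NoIterOp (T P : C ⥤ C) (u : 𝟭 C ⟶ T) (η : 𝟭 C ⟶ P)
    (m : T ⋙ T ⟶ T) (μ : P ⋙ P ⟶ P)
    (Lam : ∀ X Y : C, (X ⟶ P.obj (T.obj Y)) → (T.obj X ⟶ P.obj (T.obj Y))) : Prop :=
  (∀ (X Y : C) (f : X ⟶ P.obj (T.obj Y)), u.app X ≫ Lam X Y f = f) ∧
  (∀ X : C, Lam (T.obj X) X (η.app (T.obj X)) = m.app X ≫ η.app (T.obj X)) ∧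
  (∀ (X Y Z : C) (f : X ⟶ P.obj (T.obj Y)) (g : Y ⟶ P.obj (T.obj Z)),
      Lam X Z (f ≫ P.map (Lam Y Z g) ≫ μ.app (T.obj Z)) =
        Lam X Y f ≫ P.map (Lam Y Z g) ≫ μ.app (T.obj Z))

/-- The operator `g ↦ P(m) ∘ λ ∘ T(g)` lands in morphisms that commute with `m` and the
`T`-action `P(m) ∘ λ` on `P T Z`. -/
lemma IsBeckDistLaw.map_comp_action {T P : C ⥤ C} {u : 𝟭 C ⟶ T} {η : 𝟭 C ⟶ P}
    {m : T ⋙ T ⟶ T} {μ : P ⋙ P ⟶ P} {lam : P ⋙ T ⟶ T ⋙ P}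
    (hlam : IsBeckDistLaw T P u η m μ lam) (hT : IsMonad T u m)
    {Y Z : C} (g : Y ⟶ P.obj (T.obj Z)) :
    T.map (T.map g ≫ lam.app (T.obj Z) ≫ P.map (m.app Z)) ≫
        lam.app (T.obj Z) ≫ P.map (m.app Z) =
      m.app Y ≫ T.map g ≫ lam.app (T.obj Z) ≫ P.map (m.app Z) := by
  have lam_nat := lam.naturality (m.app Z)
  have m_nat := m.naturality g
  have pentagon := hlam.2.2.1 (T.obj Z)
  have assoc := hT.2.2 Z
  dsimp at lam_nat m_nat pentagon
  calc
    _ = T.map (T.map g) ≫ T.map (lam.app (T.obj Z)) ≫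
          (T.map (P.map (m.app Z)) ≫ lam.app (T.obj Z)) ≫ P.map (m.app Z) := by simp
    _ = T.map (T.map g) ≫ T.map (lam.app (T.obj Z)) ≫ lam.app (T.obj (T.obj Z)) ≫
          P.map (T.map (m.app Z) ≫ m.app Z) := by simp [lam_nat]
    _ = T.map (T.map g) ≫ (T.map (lam.app (T.obj Z)) ≫ lam.app (T.obj (T.obj Z)) ≫
          P.map (m.app (T.obj Z))) ≫ P.map (m.app Z) := by simp [← assoc]
    _ = (T.map (T.map g) ≫ m.app (P.obj (T.obj Z))) ≫ lam.app (T.obj Z) ≫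
          P.map (m.app Z) := by rw [← pentagon]; simp
    _ = _ := by rw [m_nat]; simp

/-- If `λ` is a Beck distributive law, then `Λ(f) = P(m_Y) ∘ λ_{T Y} ∘ T(f)` is a
no-iteration distributive-law operator for `T` over `P`. -/
theorem noIterOp_of_beckDistLaw (T P : C ⥤ C) (u : 𝟭 C ⟶ T) (η : 𝟭 C ⟶ P)
    (m : T ⋙ T ⟶ T) (μ : P ⋙ P ⟶ P)
    (hT : IsMonad T u m) (hP : IsMonad P η μ)
    (lam : P ⋙ T ⟶ T ⋙ P) (hlam : IsBeckDistLaw T P u η m μ lam) :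
    NoIterOp T P u η m μ
      (fun X Y f => T.map f ≫ lam.app (T.obj Y) ≫ P.map (m.app Y)) := by
  refine ⟨fun X Y f => ?_, fun X => ?_, fun X Y Z f g => ?_⟩
  · have u_nat := u.naturality f
    dsimp at u_nat ⊢
    rw [← reassoc_of% u_nat, reassoc_of% (hlam.1 (T.obj Y)), ← P.map_comp, hT.1 Y]
    simp
  · have η_nat := η.naturality (m.app X)
    dsimp at η_nat ⊢
    rw [reassoc_of% (hlam.2.1 (T.obj X)), η_nat]
  · have action := hlam.map_comp_action hT g
    beta_reduce
    generalize T.map g ≫ lam.app (T.obj Z) ≫ P.map (m.app Z) = h at action ⊢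
    have lam_nat := lam.naturality h
    have μ_nat := μ.naturality (m.app Z)
    have pentagon := hlam.2.2.2 (T.obj Z)
    dsimp at lam_nat μ_nat pentagon
    calc
      _ = T.map f ≫ T.map (P.map h) ≫ (T.map (μ.app (T.obj Z)) ≫ lam.app (T.obj Z)) ≫
            P.map (m.app Z) := by simp
      _ = T.map f ≫ (T.map (P.map h) ≫ lam.app (P.obj (T.obj Z))) ≫
            P.map (lam.app (T.obj Z)) ≫ μ.app (T.obj (T.obj Z)) ≫ P.map (m.app Z) := by
          rw [pentagon]; simp
      _ = T.map f ≫ lam.app (T.obj Y) ≫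
            P.map (T.map h ≫ lam.app (T.obj Z) ≫ P.map (m.app Z)) ≫ μ.app (T.obj Z) := by
          rw [lam_nat, ← μ_nat]; simp
      _ = _ := by rw [action]; simp
end

section
/- Let λ : T∘P ⟶ P∘T be a natural transformation satisfying the two unit triangles λ_X ∘ u_{P X} = P(u_X), λ_X ∘ T(η_X) = η_{T X} and the decagon condition. Define ũ_X := η_{T X} ∘ u_X : X → P T X, and for f : X → P T Y define f^† := P(m_Y) ∘ λ_{T Y} ∘ T(f) : T X → P T Y. Then the data (X ↦ T X, ũ, (−)^†) is a Kleisli triple on the Kleisli category Kl(P), i.e.: (1) μ_{T Y} ∘ P(f^†) ∘ ũ_X = f for every f : X → P T Y; (2) (ũ_X)^† = η_{T X} for every X; (3) (μ_{T Z} ∘ P(g^†) ∘ f)^† = μ_{T Z} ∘ P(g^†) ∘ f^† for all f : X → P T Y and g : Y → P T Z. -/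
open CategoryTheory

universe v u

variable {C : Type u} [Category.{v} C]

/-- If `λ` satisfies the two unit triangles and the decagon condition, then the data
`(X ↦ T X, ũ_X := η_{T X} ∘ u_X, f^† := P(m_Y) ∘ λ_{T Y} ∘ T(f))` is a Kleisli triple
on the Kleisli category of `P` (whose composition of `f : X ⇝ Y`, `g : Y ⇝ Z` is
`μ_Z ∘ P(g) ∘ f`). -/
theorem kleisliTriple_of_decagon (T P : C ⥤ C) (u : 𝟭 C ⟶ T) (η : 𝟭 C ⟶ P)
    (m : T ⋙ T ⟶ T) (μ : P ⋙ P ⟶ P)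
    (hT : IsMonad T u m) (hP : IsMonad P η μ)
    (lam : P ⋙ T ⟶ T ⋙ P)
    (htri1 : ∀ X : C, u.app (P.obj X) ≫ lam.app X = P.map (u.app X))
    (htri2 : ∀ X : C, T.map (η.app X) ≫ lam.app X = η.app (T.obj X))
    (hdec : Decagon T P m μ lam) :
    -- (1) `μ_{T Y} ∘ P(f^†) ∘ ũ_X = f`
    (∀ (X Y : C) (f : X ⟶ P.obj (T.obj Y)),
        (u.app X ≫ η.app (T.obj X)) ≫
            P.map (T.map f ≫ lam.app (T.obj Y) ≫ P.map (m.app Y)) ≫ μ.app (T.obj Y) = f) ∧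
    -- (2) `(ũ_X)^† = η_{T X}`
    (∀ X : C,
        T.map (u.app X ≫ η.app (T.obj X)) ≫ lam.app (T.obj X) ≫ P.map (m.app X) =
          η.app (T.obj X)) ∧
    -- (3) `(μ_{T Z} ∘ P(g^†) ∘ f)^† = μ_{T Z} ∘ P(g^†) ∘ f^†`
    (∀ (X Y Z : C) (f : X ⟶ P.obj (T.obj Y)) (g : Y ⟶ P.obj (T.obj Z)),
        T.map (f ≫ P.map (T.map g ≫ lam.app (T.obj Z) ≫ P.map (m.app Z)) ≫
              μ.app (T.obj Z)) ≫ lam.app (T.obj Z) ≫ P.map (m.app Z) =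
          (T.map f ≫ lam.app (T.obj Y) ≫ P.map (m.app Y)) ≫
            P.map (T.map g ≫ lam.app (T.obj Z) ≫ P.map (m.app Z)) ≫ μ.app (T.obj Z)) := by
  obtain ⟨hT₁, hT₂, -⟩ := hT
  obtain ⟨hP₁, -, -⟩ := hP
  refine ⟨fun X Y f => ?_, fun X => ?_, fun X Y Z f g => ?_⟩
  · have hη : ∀ {A B : C} (h : A ⟶ P.obj B), η.app A ≫ P.map h ≫ μ.app B = h := by
      intro A B h
      have nat : h ≫ η.app (P.obj B) = η.app A ≫ P.map h := η.naturality h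
      rw [← Category.assoc, ← nat, Category.assoc, hP₁, Category.comp_id]
    have nat : f ≫ u.app (P.obj (T.obj Y)) = u.app X ≫ T.map f := u.naturality f
    rw [Category.assoc, hη, ← Category.assoc, ← nat, Category.assoc,
      ← Category.assoc (u.app _), htri1, ← P.map_comp, hT₁]
    exact (congrArg (f ≫ ·) (P.map_id _)).trans (Category.comp_id f)
  · have nat : m.app X ≫ η.app (T.obj X) = η.app (T.obj (T.obj X)) ≫ P.map (m.app X) :=
      η.naturality (m.app X)
    rw [T.map_comp, Category.assoc, ← Category.assoc (T.map (η.app _)), htri2, ← nat,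
      ← Category.assoc, hT₂]
    exact Category.id_comp _
  · have nat_lam : T.map (P.map (T.map g)) ≫ lam.app (T.obj (P.obj (T.obj Z))) =
        lam.app (T.obj Y) ≫ P.map (T.map (T.map g)) := lam.naturality (T.map g)
    have nat_m : T.map (T.map g) ≫ m.app (P.obj (T.obj Z)) = m.app Y ≫ T.map g :=
      m.naturality g
    have nat_Pm := congrArg P.map nat_m
    simp only [P.map_comp] at nat_Pm
    simp only [Functor.map_comp, Category.assoc]
    rw [hdec Z, reassoc_of% nat_lam, reassoc_of% nat_Pm]
end
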